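/- Let X ⊆ ℝ^d be nonempty, compact, and convex, Ξ a metric space with Borel σ-algebra, f : X → ℝ continuous and convex, g : X × Ξ → ℝ jointly continuous with y ↦ g(y, ξ) convex for each ξ, and for each x ∈ X let P_x be a probability measure on Ξ with x ↦ P_x weakly continuous. Assume boundary regularity P_x({g(y, ξ) = γ}) = 0 for all x, y ∈ X, that X_ε^γ(x) = {y ∈ X : P_x({g(y, ξ) ≤ γ}) ≥ 1 − ε} is nonempty for every x ∈ X, that this feasibility correspondence is lower hemicontinuous, and that Φ(x) = argmin_{y ∈ X_ε^γ(x)} f(y) is convex-valued. Then there exists a performative solution: a point x⋆ ∈ X with x⋆ ∈ Φ(x⋆), i.e., x⋆ is feasible under the distribution it induces (P_{x⋆}({g(x⋆, ξ) ≤ γ}) ≥ 1 − ε) and minimizes f over X_ε^γ(x⋆). -/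

import Mathlib

open MeasureTheory Filter
open scoped Topology

section Brouwer
variable {E : Type*} [NormedAddCommGroup E] [InnerProductSpace ℝ E] [FiniteDimensional ℝ E]

lemma det_poly (A : E →L[ℝ] E) : ∃ p : Polynomial ℝ, p.natDegree ≤ Module.finrank ℝ E ∧
    ∀ s : ℝ, p.eval s = (ContinuousLinearMap.id ℝ E + s • A).det := by
  classical
  let b := Module.finBasis ℝ E
  let M := LinearMap.toMatrix b b (A : E →ₗ[ℝ] E)
  refine ⟨Matrix.det ((Polynomial.X : Polynomial ℝ) • M.map Polynomial.C +
    (1 : Matrix _ _ ℝ).map Polynomial.C), ?_, ?_⟩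
  · simpa using Polynomial.natDegree_det_X_add_C_le M 1
  · intro s
    have h1 : (ContinuousLinearMap.id ℝ E + s • A).det
        = Matrix.det (1 + s • M) := by
      rw [ContinuousLinearMap.det, ← LinearMap.det_toMatrix b]
      congr 1
      ext i j
      simp [M, LinearMap.toMatrix_apply, Matrix.one_apply, Finsupp.single_apply, eq_comm]
    rw [h1, ← Polynomial.coe_evalRingHom, RingHom.map_det]
    congr 1
    ext i j
    by_cases hij : i = j <;> simp [hij, add_comm] <;> ring

lemma surj_of_det_ne_zero (A : E →L[ℝ] E) (h : A.det ≠ 0) : Function.Surjective A := by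
  have h1 : Function.Injective (A : E →ₗ[ℝ] E) := by
    rw [← LinearMap.ker_eq_bot]
    by_contra h2
    exact h (LinearMap.det_eq_zero_iff_ker_ne_bot.2 h2)
  exact LinearMap.injective_iff_surjective.1 h1

lemma det_id_add_inj (A : E →L[ℝ] E) {C s : ℝ} (hA : ‖A‖ ≤ C) (hs : 0 ≤ s) (hsC : s * C < 1) :
    (ContinuousLinearMap.id ℝ E + s • A).det ≠ 0 := by
  intro h
  have := LinearMap.bot_lt_ker_of_det_eq_zero (f := ((ContinuousLinearMap.id ℝ E + s • A : E →L[ℝ] E) : E →ₗ[ℝ] E)) h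
  rw [bot_lt_iff_ne_bot] at this
  obtain ⟨v, hv, hv0⟩ := (Submodule.ne_bot_iff _).1 this
  have hv' : v + s • A v = 0 := by simpa using hv
  have h2 : ‖v‖ = s * ‖A v‖ := by
    have : v = - (s • A v) := eq_neg_of_add_eq_zero_left hv'
    calc ‖v‖ = ‖- (s • A v)‖ := by rw [← this]
      _ = _ := by rw [norm_neg, norm_smul, Real.norm_of_nonneg hs]
  have h3 : ‖A v‖ ≤ C * ‖v‖ := (A.le_opNorm v).trans (by gcongr)
  have h4 : 0 < ‖v‖ := norm_pos_iff.2 hv0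
  nlinarith [mul_le_mul_of_nonneg_left h3 hs]

lemma det_id_add_pos (A : E →L[ℝ] E) {C s : ℝ} (hA : ‖A‖ ≤ C) (hs : 0 ≤ s) (hsC : s * C < 1) :
    0 < (ContinuousLinearMap.id ℝ E + s • A).det := by
  obtain ⟨p, -, hp⟩ := det_poly A
  by_contra hneg
  push Not at hneg
  rw [← hp] at hneg
  have h0 : p.eval 0 = 1 := by rw [hp]; simp [ContinuousLinearMap.det]
  have hC : 0 ≤ C := (norm_nonneg A).trans hA
  have := intermediate_value_Icc' hs (f := fun x => p.eval x) p.continuous.continuousOn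
  obtain ⟨u, hu, hu0⟩ := this ⟨hneg, by simp [h0]⟩
  refine det_id_add_inj A (s := u) hA hu.1 ?_ ?_
  · nlinarith [mul_le_mul_of_nonneg_right hu.2 hC]
  · rw [← hp]; exact hu0

variable [MeasurableSpace E] [BorelSpace E]

/-- There is no `C¹` retraction of a ball onto its sphere. -/
lemma no_retract {R : ℝ} (hR : 0 < R) (r : E → E) (U : Set E) (hU : IsOpen U)
    (hBU : Metric.closedBall 0 R ⊆ U) (hr : ContDiffOn ℝ 1 r U)
    (h1 : ∀ x ∈ Metric.closedBall (0 : E) R, ‖r x‖ = R)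
    (h2 : ∀ x, ‖x‖ = R → r x = x) : False := by
  classical
  set K := Metric.closedBall (0 : E) R with hK
  set B := Metric.ball (0 : E) R with hB
  have hBK : B ⊆ K := Metric.ball_subset_closedBall
  let g : E → E := fun x => r x - x
  have hg : ContDiffOn ℝ 1 g U := hr.sub contDiffOn_id
  have hgc : ContinuousOn (fun x => fderiv ℝ g x) U := hg.continuousOn_fderiv_of_isOpen hU le_rfl
  have hgat : ∀ x ∈ U, ContDiffAt ℝ 1 g x := fun x hx => hg.contDiffAt (hU.mem_nhds hx)
  have hcomp : IsCompact K := isCompact_closedBall _ _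
  obtain ⟨C0, hC0⟩ := hcomp.exists_bound_of_continuousOn (hgc.mono hBU)
  set C := max C0 1 with hCdef
  have hC1 : 1 ≤ C := le_max_right _ _
  have hC : ∀ x ∈ K, ‖fderiv ℝ g x‖ ≤ C := fun x hx => (hC0 x hx).trans (le_max_left _ _)
  have hlip : ∀ x ∈ K, ∀ y ∈ K, ‖g y - g x‖ ≤ C * ‖y - x‖ := fun x hx y hy =>
    Convex.norm_image_sub_le_of_norm_fderiv_le (𝕜 := ℝ)
      (fun z hz => (hgat z (hBU hz)).differentiableAt (by simp)) hC (convex_closedBall _ _) hx hy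
  let J : ℝ → E → ℝ := fun s x => (ContinuousLinearMap.id ℝ E + s • fderiv ℝ g x).det
  have hJc : ∀ s, ContinuousOn (J s) K := by
    intro s
    have : ContinuousOn (fun x => ContinuousLinearMap.id ℝ E + s • fderiv ℝ g x) K :=
      continuousOn_const.add ((hgc.mono hBU).const_smul s)
    exact ContinuousLinearMap.continuous_det.comp_continuousOn this
  have hJint : ∀ s, IntegrableOn (J s) B := fun s =>
    ((hJc s).integrableOn_compact hcomp).mono_set hBK
  -- volume for small times
  have hsmall : ∀ s, 0 ≤ s → s * C < 1 → ∫ x in B, J s x = volume.real B := by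
    intro s hs hsC
    have hs1 : s < 1 := by nlinarith
    let h : E → E := fun x => x + s • g x
    have hh : ∀ x, h x = (1 - s) • x + s • r x := by
      intro x; simp only [h, g, smul_sub, sub_smul, one_smul]; abel
    have hder : ∀ x ∈ K, HasStrictFDerivAt h (ContinuousLinearMap.id ℝ E + s • fderiv ℝ g x) x := by
      intro x hx
      exact (hasStrictFDerivAt_id x).add
        (((hgat x (hBU hx)).hasStrictFDerivAt (by simp)).const_smul s)
    have hinj : Set.InjOn h K := by
      intro x hx y hy hxy
      have e : y - x = - (s • (g y - g x)) := by
        have : x + s • g x = y + s • g y := hxy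
        rw [smul_sub]
        have h3 : y = x + s • g x - s • g y := by rw [this]; abel
        nth_rewrite 1 [h3]; abel
      have e2 : ‖y - x‖ = s * ‖g y - g x‖ := by
        rw [e, norm_neg, norm_smul, Real.norm_of_nonneg hs]
      have e3 := hlip x hx y hy
      have : ‖y - x‖ ≤ s * C * ‖y - x‖ := by
        calc ‖y - x‖ = s * ‖g y - g x‖ := e2
          _ ≤ s * (C * ‖y - x‖) := mul_le_mul_of_nonneg_left e3 hs
          _ = _ := by ring
      by_contra hne
      have : 0 < ‖y - x‖ := norm_pos_iff.2 (sub_ne_zero.2 (Ne.symm hne))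
      nlinarith
    have hmaps : h '' B ⊆ B := by
      rintro _ ⟨x, hx, rfl⟩
      rw [mem_ball_zero_iff] at hx ⊢
      rw [hh]
      calc _ ≤ ‖(1 - s) • x‖ + ‖s • r x‖ := norm_add_le _ _
        _ = (1 - s) * ‖x‖ + s * R := by
          rw [norm_smul, norm_smul, Real.norm_of_nonneg hs, Real.norm_of_nonneg (by linarith),
            h1 x (hBK (mem_ball_zero_iff.2 hx))]
        _ < R := by nlinarith
    have hcont : ContinuousOn h K := fun x hx => (hder x hx).continuousAt.continuousWithinAt
    have hopen : IsOpen (h '' B) := by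
      rw [isOpen_iff_mem_nhds]
      rintro _ ⟨x, hx, rfl⟩
      have hdet := det_id_add_inj (fderiv ℝ g x) (hC x (hBK hx)) hs hsC
      have hsurj : (ContinuousLinearMap.id ℝ E + s • fderiv ℝ g x : E →L[ℝ] E).range = ⊤ := by
        exact LinearMap.range_eq_top.2 (surj_of_det_ne_zero _ hdet)
      rw [← (hder x (hBK hx)).map_nhds_eq_of_surj hsurj]
      exact image_mem_map (Metric.isOpen_ball.mem_nhds hx)
    have himage : h '' B = B := by
      refine hmaps.antisymm ?_
      refine IsPreconnected.subset_of_closure_inter_subset (convex_ball (0 : E) R).isPreconnected hopen ?_ ?_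
      · refine ⟨h 0, hmaps ⟨0, Metric.mem_ball_self hR, rfl⟩, ⟨0, Metric.mem_ball_self hR, rfl⟩⟩
      · rintro y ⟨hy, hyB⟩
        have hcl : IsClosed (h '' K) := (hcomp.image_of_continuousOn hcont).isClosed
        obtain ⟨x, hx, rfl⟩ := closure_minimal (Set.image_mono hBK) hcl hy
        refine ⟨x, ?_, rfl⟩
        rw [hB, mem_ball_zero_iff]
        refine lt_of_le_of_ne (mem_closedBall_zero_iff.1 hx) ?_
        intro hxR
        have : h x = x := by simp [h, g, h2 x hxR]
        rw [this, hB, mem_ball_zero_iff] at hyB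
        linarith
    have key := integral_image_eq_integral_abs_det_fderiv_smul (volume : Measure E)
      (s := B) (f := h) (f' := fun x => ContinuousLinearMap.id ℝ E + s • fderiv ℝ g x)
      Metric.isOpen_ball.measurableSet
      (fun x hx => (hder x (hBK hx)).hasFDerivAt.hasFDerivWithinAt) (hinj.mono hBK) (fun _ => (1 : ℝ))
    rw [himage] at key
    simp only [smul_eq_mul, mul_one] at key
    rw [setIntegral_const, smul_eq_mul, mul_one] at key
    rw [key]
    refine setIntegral_congr_fun Metric.isOpen_ball.measurableSet ?_
    intro x hx
    exact (abs_of_pos (det_id_add_pos (fderiv ℝ g x) (hC x (hBK hx)) hs hsC)).symm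
  -- at time one
  have hone : ∀ x ∈ B, J 1 x = 0 := by
    intro x hx
    by_contra hne
    have hU' : ContDiffAt ℝ 1 r x := hr.contDiffAt (hU.mem_nhds (hBU (hBK hx)))
    have hrd : HasFDerivAt r (fderiv ℝ r x) x := (hU'.differentiableAt (by simp)).hasFDerivAt
    have hge : ContinuousLinearMap.id ℝ E + (1 : ℝ) • fderiv ℝ g x = fderiv ℝ r x := by
      have : HasFDerivAt g (fderiv ℝ r x - ContinuousLinearMap.id ℝ E) x := hrd.sub (hasFDerivAt_id x)
      rw [this.fderiv]; simp
    simp only [J, hge] at hne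
    have hns : HasFDerivAt (fun y => ‖r y‖ ^ 2) _ x := hrd.norm_sq
    have hns2 : HasFDerivAt (fun y => ‖r y‖ ^ 2) (0 : E →L[ℝ] ℝ) x := by
      refine (hasFDerivAt_const (R ^ 2) x).congr_of_eventuallyEq ?_
      filter_upwards [Metric.isOpen_ball.mem_nhds hx] with y hy
      rw [h1 y (hBK hy)]
    have heq := hns.unique hns2
    have hsurj : Function.Surjective (fderiv ℝ r x) := surj_of_det_ne_zero _ hne
    obtain ⟨v, hv⟩ := hsurj (r x)
    have := congrArg (fun L => L v) heq
    simp [hv, h1 x (hBK hx)] at this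
    linarith
  -- interpolation
  let n := Module.finrank ℝ E + 1
  let T : ℝ := (C * (n + 1))⁻¹
  let node : ℕ → ℝ := fun i => i * T
  have hTpos : 0 < T := by positivity
  have hnode : ∀ i ∈ Finset.range n, node i * C < 1 := by
    intro i hi
    have : (i : ℝ) < n + 1 := by
      have := Finset.mem_range.1 hi
      have : (i : ℝ) < n := by exact_mod_cast this
      linarith
    simp only [node, T]
    rw [mul_inv, mul_assoc]
    have hc : C⁻¹ * ((n : ℝ) + 1)⁻¹ * C = ((n : ℝ) + 1)⁻¹ := by
      field_simp
    rw [hc, ← div_eq_mul_inv, div_lt_one (by positivity)]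
    exact this
  have hinjn : Set.InjOn node (Finset.range n) := by
    intro i _ j _ hij
    have : (i : ℝ) = j := mul_right_cancel₀ hTpos.ne' hij
    exact_mod_cast this
  let c : ℕ → ℝ := fun i => (Lagrange.basis (Finset.range n) node i).eval 1
  have hcsum : ∑ i ∈ Finset.range n, c i = 1 := by
    have := congrArg (Polynomial.eval 1) (Lagrange.sum_basis hinjn ⟨0, by simp [n]⟩)
    simpa [Polynomial.eval_finsetSum, c] using this
  have hinterp : ∀ x, J 1 x = ∑ i ∈ Finset.range n, c i * J (node i) x := by
    intro x
    obtain ⟨p, hpd, hp⟩ := det_poly (fderiv ℝ g x)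
    have hdeg : p.degree < (Finset.range n).card := by
      rw [Finset.card_range]
      refine lt_of_le_of_lt Polynomial.degree_le_natDegree ?_
      exact_mod_cast Nat.lt_succ_of_le hpd
    have := congrArg (Polynomial.eval 1) (Lagrange.eq_interpolate hinjn hdeg)
    rw [hp] at this
    simp only [J]
    rw [this, Lagrange.interpolate_apply, Polynomial.eval_finsetSum]
    refine Finset.sum_congr rfl fun i _ => ?_
    simp [c, hp, mul_comm]
  have hI : ∫ x in B, J 1 x = volume.real B := by
    simp_rw [hinterp]
    rw [integral_finsetSum _ (fun i _ => (hJint (node i)).const_mul (c i))]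
    simp_rw [integral_const_mul]
    rw [Finset.sum_congr rfl (fun i hi => by
      rw [hsmall (node i) (by positivity) (hnode i hi)]), ← Finset.sum_mul, hcsum, one_mul]
  have hI0 : ∫ x in B, J 1 x = 0 := by
    rw [setIntegral_congr_fun Metric.isOpen_ball.measurableSet hone]; simp
  have hpos : 0 < volume.real B :=
    ENNReal.toReal_pos (Metric.measure_ball_pos volume 0 hR).ne' measure_ball_lt_top.ne
  linarith

end Brouwer

section Kakutani
variable {E : Type*} [NormedAddCommGroup E] [InnerProductSpace ℝ E] [FiniteDimensional ℝ E]

/-- Brouwer for `C¹` maps of a ball. -/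
lemma brouwer_smooth {R : ℝ} (hR : 0 < R) (f : E → E) (hf : ContDiff ℝ 1 f)
    (hmap : ∀ x ∈ Metric.closedBall (0 : E) R, f x ∈ Metric.closedBall (0 : E) R) :
    ∃ x ∈ Metric.closedBall (0 : E) R, f x = x := by
  borelize E
  by_contra! hno
  let u : E → E := fun x => x - f x
  have hu : ContDiff ℝ 1 u := contDiff_id.sub hf
  let D : E → ℝ := fun x => (inner ℝ x (u x)) ^ 2 + ‖u x‖ ^ 2 * (R ^ 2 - ‖x‖ ^ 2)
  have hin : ContDiff ℝ 1 (fun x => inner ℝ x (u x)) := contDiff_id.inner ℝ hu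
  have hD : ContDiff ℝ 1 D :=
    (hin.pow 2).add ((hu.norm_sq ℝ).mul (contDiff_const.sub (contDiff_id.norm_sq ℝ)))
  let lam : E → ℝ := fun x => (- inner ℝ x (u x) + Real.sqrt (D x)) / ‖u x‖ ^ 2
  let r : E → E := fun x => x + lam x • u x
  let U : Set E := {x | 0 < D x} ∩ {x | u x ≠ 0}
  have hu0 : ∀ x ∈ Metric.closedBall (0 : E) R, u x ≠ 0 := fun x hx h =>
    hno x hx (sub_eq_zero.1 h).symm
  have hbd : ∀ x, ‖x‖ = R → 0 < inner ℝ x (u x) := by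
    intro x hx
    have hxK : x ∈ Metric.closedBall (0 : E) R := by simp [hx]
    have hfx : ‖f x‖ ≤ R := by simpa using hmap x hxK
    have h3 : ‖x - f x‖ ^ 2 = ‖x‖ ^ 2 - 2 * inner ℝ x (f x) + ‖f x‖ ^ 2 := norm_sub_sq_real _ _
    have h4 : 0 < ‖x - f x‖ := norm_pos_iff.2 (hu0 x hxK)
    have h5 : inner ℝ x (u x) = ‖x‖ ^ 2 - inner ℝ x (f x) := by
      simp only [u]; rw [inner_sub_right, real_inner_self_eq_norm_sq]
    rw [h5]
    have h6 : ‖f x‖ ^ 2 ≤ R ^ 2 := by gcongr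
    rw [hx] at h3 ⊢
    nlinarith [pow_pos h4 2]
  have hDpos : ∀ x ∈ Metric.closedBall (0 : E) R, 0 < D x := by
    intro x hx
    have hxR : ‖x‖ ≤ R := by simpa using hx
    have hun : 0 < ‖u x‖ := norm_pos_iff.2 (hu0 x hx)
    rcases hxR.eq_or_lt with h | h
    · have := hbd x h
      simp only [D]; rw [h]; simp; positivity
    · have : 0 < R ^ 2 - ‖x‖ ^ 2 := by nlinarith [norm_nonneg x]
      simp only [D]; positivity
  refine no_retract hR r U ?_ ?_ ?_ ?_ ?_
  · exact (isOpen_lt continuous_const hD.continuous).inter (isOpen_ne_fun hu.continuous continuous_const)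
  · exact fun x hx => ⟨hDpos x hx, hu0 x hx⟩
  · intro x hx
    apply ContDiffAt.contDiffWithinAt
    have hs : ContDiffAt ℝ 1 (fun x => Real.sqrt (D x)) x := hD.contDiffAt.sqrt (ne_of_gt hx.1)
    have hl : ContDiffAt ℝ 1 lam x :=
      (hin.contDiffAt.neg.add hs).div (hu.norm_sq ℝ).contDiffAt (by
        have := hx.2; simpa using this)
    exact contDiffAt_id.add (hl.smul hu.contDiffAt)
  · intro x hx
    have hun : ‖u x‖ ^ 2 ≠ 0 := by simpa using hu0 x hx
    have hsq : Real.sqrt (D x) ^ 2 = D x := Real.sq_sqrt (hDpos x hx).le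
    have hl : lam x * ‖u x‖ ^ 2 = - inner ℝ x (u x) + Real.sqrt (D x) := by
      exact div_mul_cancel₀ _ hun
    have : ‖r x‖ ^ 2 = R ^ 2 := by
      simp only [r]
      rw [norm_add_sq_real, inner_smul_right, norm_smul, mul_pow, Real.norm_eq_abs, sq_abs]
      have h7 : ‖u x‖ ^ 2 * (‖x‖ ^ 2 + 2 * (lam x * inner ℝ x (u x)) + lam x ^ 2 * ‖u x‖ ^ 2 - R ^ 2) = 0 := by
        have : ‖u x‖ ^ 2 * (‖x‖ ^ 2 + 2 * (lam x * inner ℝ x (u x)) + lam x ^ 2 * ‖u x‖ ^ 2 - R ^ 2)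
          = (lam x * ‖u x‖ ^ 2 + inner ℝ x (u x)) ^ 2 - D x := by simp only [D]; ring
        rw [this, hl]
        ring_nf
        rw [hsq]; ring
      have := (mul_eq_zero.1 h7).resolve_left hun
      linarith
    exact (pow_left_inj₀ (norm_nonneg _) hR.le two_ne_zero).1 this
  · intro x hx
    have : D x = (inner ℝ x (u x)) ^ 2 := by simp [D, hx]
    have : lam x = 0 := by simp [lam, this, Real.sqrt_sq (hbd x hx).le]
    simp [r, this]

/-- Kakutani's fixed point theorem. -/
lemma kakutani (X : Set E) (hXne : X.Nonempty) (hXcomp : IsCompact X) (hXconv : Convex ℝ X)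
    (Φ : E → Set E) (hsub : ∀ x ∈ X, Φ x ⊆ X) (hne : ∀ x ∈ X, (Φ x).Nonempty)
    (hconv : ∀ x ∈ X, Convex ℝ (Φ x))
    (hclosed : ∀ (x y : ℕ → E) (a b : E), (∀ n, x n ∈ X) → a ∈ X → Tendsto x atTop (𝓝 a) →
      (∀ n, y n ∈ Φ (x n)) → Tendsto y atTop (𝓝 b) → b ∈ Φ a) :
    ∃ x ∈ X, x ∈ Φ x := by
  obtain ⟨R, hR, hXR⟩ := hXcomp.isBounded.subset_closedBall_lt 0 (0 : E)
  have approx : ∀ δ : ℝ, 0 < δ → ∃ x ∈ X,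
      x ∈ convexHull ℝ (⋃ y ∈ {y | y ∈ X ∧ dist x y < δ}, Φ y) := by
    intro δ hδ
    let t : E → Set E := fun x =>
      convexHull ℝ (⋃ y ∈ {y | y ∈ X ∧ dist x y < δ + Metric.infDist x X}, Φ y)
    have htX : ∀ x, t x ⊆ X := fun x => convexHull_min
      (Set.iUnion₂_subset fun y hy => hsub y hy.1) hXconv
    obtain ⟨f, hf⟩ := exists_contMDiffMap_forall_mem_convex_of_local_const
      (n := (1 : ℕ∞)) (I := modelWithCornersSelf ℝ E) (M := E) (F := E) (t := t)
      (fun x => convex_convexHull ℝ _) (by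
        intro x0
        obtain ⟨y0, hy0, hd⟩ := (Metric.infDist_lt_iff (s := X) (x := x0) hXne).1
          (show Metric.infDist x0 X < δ + Metric.infDist x0 X by linarith)
        obtain ⟨c, hc⟩ := hne y0 hy0
        refine ⟨c, ?_⟩
        have hop : IsOpen {x : E | dist x y0 < δ + Metric.infDist x X} :=
          isOpen_lt (continuous_id.dist continuous_const)
            (continuous_const.add (Metric.continuous_infDist_pt X))
        filter_upwards [hop.mem_nhds hd] with x hx
        exact subset_convexHull ℝ _ (Set.mem_iUnion₂.2 ⟨y0, ⟨hy0, hx⟩, hc⟩))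
    have hfs : ContDiff ℝ 1 f := f.contMDiff.contDiff
    obtain ⟨x, hxK, hx⟩ := brouwer_smooth hR f hfs (fun x _ => hXR (htX x (hf x)))
    have hxX : x ∈ X := hx ▸ htX x (hf x)
    refine ⟨x, hxX, ?_⟩
    have := hf x
    rw [hx] at this
    simpa only [t, Metric.infDist_zero_of_mem hxX, add_zero] using this
  choose! z hzX hz using approx
  let w : ℕ → E := fun n => z (1 / ((n : ℝ) + 1))
  have hpos : ∀ n : ℕ, (0 : ℝ) < 1 / ((n : ℝ) + 1) := fun n => by positivity
  obtain ⟨a, haX, φ, hφ, hlim⟩ := hXcomp.tendsto_subseq (x := w) (fun n => hzX _ (hpos n))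
  refine ⟨a, haX, ?_⟩
  have hconst : ∀ b, b ∈ closure (Φ a) → b ∈ Φ a := by
    intro b hb
    obtain ⟨y, hy, hyl⟩ := mem_closure_iff_seq_limit.1 hb
    exact hclosed (fun _ => a) y a b (fun _ => haX) haX tendsto_const_nhds hy hyl
  apply hconst
  -- upper hemicontinuity
  have uhc : ∀ η > 0, ∃ δ > 0, ∀ y ∈ X, dist y a < δ → Φ y ⊆ Metric.thickening η (Φ a) := by
    intro η hη
    by_contra! hcon
    have h1 : ∀ n : ℕ, ∃ y ∈ X, dist y a < 1 / ((n : ℝ) + 1) ∧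
        ∃ v ∈ Φ y, v ∉ Metric.thickening η (Φ a) := by
      intro n
      obtain ⟨y, hy, hd, hns⟩ := hcon _ (hpos n)
      exact ⟨y, hy, hd, Set.not_subset.1 hns⟩
    choose y hyX hyd v hv hvn using h1
    obtain ⟨b, hbX, ψ, hψ, hbl⟩ := hXcomp.tendsto_subseq (fun n => hsub _ (hyX n) (hv n))
    have hya : Tendsto y atTop (𝓝 a) := by
      rw [tendsto_iff_dist_tendsto_zero]
      exact squeeze_zero (fun _ => dist_nonneg) (fun n => (hyd n).le)
        tendsto_one_div_add_atTop_nhds_zero_nat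
    have hb : b ∈ Φ a := hclosed (y ∘ ψ) (v ∘ ψ) a b (fun n => hyX _) haX
      (hya.comp hψ.tendsto_atTop) (fun n => hv _) hbl
    have hcl : b ∈ (Metric.thickening η (Φ a))ᶜ :=
      Metric.isOpen_thickening.isClosed_compl.mem_of_tendsto hbl
        (Eventually.of_forall fun n => hvn _)
    exact hcl (Metric.self_subset_thickening hη _ hb)
  rw [Metric.mem_closure_iff]
  intro η hη
  obtain ⟨δ, hδ, hδs⟩ := uhc (η / 2) (by positivity)
  have e1 : ∀ᶠ n in atTop, dist (w (φ n)) a < min (δ / 2) (η / 2) :=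
    (tendsto_iff_dist_tendsto_zero.1 hlim).eventually (gt_mem_nhds (by positivity))
  have e2 : ∀ᶠ n in atTop, 1 / (((φ n : ℕ) : ℝ) + 1) < δ / 2 :=
    (tendsto_one_div_add_atTop_nhds_zero_nat.comp hφ.tendsto_atTop).eventually
      (gt_mem_nhds (by positivity))
  obtain ⟨n, h1, h2⟩ := (e1.and e2).exists
  have hmem := hz _ (hpos (φ n))
  have hin : w (φ n) ∈ Metric.thickening (η / 2) (Φ a) := by
    refine convexHull_min (Set.iUnion₂_subset ?_) ((hconv a haX).thickening _) hmem
    rintro y ⟨hyX, hyd⟩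
    refine hδs y hyX ?_
    have h3 : dist (w (φ n)) y < 1 / (((φ n : ℕ) : ℝ) + 1) := hyd
    have h4 := dist_triangle_left y a (w (φ n))
    have h5 := lt_of_lt_of_le h1 (min_le_left _ _)
    linarith
  obtain ⟨b, hb, hbd⟩ := Metric.mem_thickening_iff.1 hin
  refine ⟨b, hb, ?_⟩
  have h4 := dist_triangle_left a b (w (φ n))
  have h5 := lt_of_lt_of_le h1 (min_le_right _ _)
  linarith

end Kakutani

/-- The feasibility correspondence has closed graph. -/
lemma feas_closed {E Ξ : Type*} [TopologicalSpace E] [MetricSpace Ξ] [MeasurableSpace Ξ] [BorelSpace Ξ]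
    (X : Set E) (g : E → Ξ → ℝ)
    (hg_cont : Continuous fun p : E × Ξ => g p.1 p.2)
    (P : E → Measure Ξ) (hPprob : ∀ x, IsProbabilityMeasure (P x))
    (hPweak : ∀ φ : BoundedContinuousFunction Ξ ℝ,
      ContinuousOn (fun x => ∫ ξ, φ ξ ∂(P x)) X) (γ : ℝ) (κ : ENNReal)
    (x y : ℕ → E) (a b : E) (hx : ∀ n, x n ∈ X) (ha : a ∈ X) (hxa : Tendsto x atTop (𝓝 a))
    (hyb : Tendsto y atTop (𝓝 b)) (h : ∀ n, κ ≤ P (x n) {ξ | g (y n) ξ ≤ γ}) :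
    κ ≤ P a {ξ | g b ξ ≤ γ} := by
  let F : ℕ → Set Ξ := fun m => closure (⋃ n ≥ m, {ξ | g (y n) ξ ≤ γ})
  have hFanti : Antitone F := fun m k hmk =>
    closure_mono (Set.biUnion_subset_biUnion_left fun n (hn : k ≤ n) => hmk.trans hn)
  let Q : E → ProbabilityMeasure Ξ := fun x => ⟨P x, hPprob x⟩
  have hlim : Tendsto (fun n => Q (x n)) atTop (𝓝 (Q a)) := by
    refine ProbabilityMeasure.tendsto_iff_forall_integral_tendsto.2 ?_
    intro φ
    exact (hPweak φ a ha).tendsto.comp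
      (tendsto_nhdsWithin_iff.2 ⟨hxa, Eventually.of_forall hx⟩)
  have hF : ∀ m, κ ≤ P a (F m) := by
    intro m
    refine le_trans ?_ (ProbabilityMeasure.limsup_measure_closed_le_of_tendsto hlim
      (isClosed_closure : IsClosed (F m)))
    refine le_limsup_of_frequently_le (Eventually.frequently ?_)
    filter_upwards [eventually_ge_atTop m] with n hn
    exact (h n).trans (measure_mono
      ((Set.subset_biUnion_of_mem (u := fun n => {ξ | g (y n) ξ ≤ γ}) hn).trans subset_closure))
  have hinter : κ ≤ P a (⋂ m, F m) := by
    have := hPprob a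
    exact ge_of_tendsto' (tendsto_measure_iInter_atTop
      (fun m => isClosed_closure.measurableSet.nullMeasurableSet) hFanti
      ⟨0, measure_ne_top _ _⟩) hF
  refine hinter.trans (measure_mono ?_)
  intro ξ hξ
  by_contra hgt
  have hgt : γ < g b ξ := not_le.1 hgt
  have hop : {p : E × Ξ | γ < g p.1 p.2} ∈ 𝓝 (b, ξ) :=
    (isOpen_lt continuous_const hg_cont).mem_nhds hgt
  rw [nhds_prod_eq] at hop
  obtain ⟨V, hV, W, hW, hVW⟩ := Filter.mem_prod_iff.1 hop
  obtain ⟨m, hm⟩ := eventually_atTop.1 (hyb.eventually hV)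
  obtain ⟨ζ, hζW, hζ⟩ := mem_closure_iff_nhds.1 (Set.mem_iInter.1 hξ m) W hW
  obtain ⟨n, hn, hζn⟩ := Set.mem_iUnion₂.1 hζ
  have h1 : γ < g (y n) ζ := hVW (Set.mk_mem_prod (hm n hn) hζW)
  exact absurd hζn (not_le.2 h1)

/-- Existence of a performative solution: a fixed point
`xstar ∈ Φ(xstar)` of the best-response correspondence of the performative
chance-constrained problem (Kakutani). -/
theorem performative_solution_exists
    {d : ℕ} {Ξ : Type*} [MetricSpace Ξ] [MeasurableSpace Ξ] [BorelSpace Ξ]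
    (X : Set (EuclideanSpace ℝ (Fin d)))
    (hXne : X.Nonempty) (hXcomp : IsCompact X) (hXconv : Convex ℝ X)
    (f : EuclideanSpace ℝ (Fin d) → ℝ) (hf : ContinuousOn f X)
    (hfconv : ConvexOn ℝ X f)
    (g : EuclideanSpace ℝ (Fin d) → Ξ → ℝ)
    (hg_cont : Continuous fun p : EuclideanSpace ℝ (Fin d) × Ξ => g p.1 p.2)
    (hg_conv : ∀ ξ : Ξ, ConvexOn ℝ X (fun y => g y ξ))
    (P : EuclideanSpace ℝ (Fin d) → Measure Ξ)
    (hPprob : ∀ x, IsProbabilityMeasure (P x))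
    (hPweak : ∀ φ : BoundedContinuousFunction Ξ ℝ,
      ContinuousOn (fun x => ∫ ξ, φ ξ ∂(P x)) X)
    (γ : ℝ) (ε : ℝ) (hε : ε ∈ Set.Ioo (0 : ℝ) 1)
    (hboundary : ∀ x ∈ X, ∀ y ∈ X, P x {ξ | g y ξ = γ} = 0)
    (feas Φ : EuclideanSpace ℝ (Fin d) → Set (EuclideanSpace ℝ (Fin d)))
    (hfeas_def : ∀ x, feas x =
      {y ∈ X | ENNReal.ofReal (1 - ε) ≤ P x {ξ | g y ξ ≤ γ}})
    (hΦ_def : ∀ x, Φ x = {y ∈ feas x | ∀ z ∈ feas x, f y ≤ f z})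
    (hfeas_ne : ∀ x ∈ X, (feas x).Nonempty)
    (hfeas_lhc : ∀ (x : ℕ → EuclideanSpace ℝ (Fin d)) (xl : EuclideanSpace ℝ (Fin d)),
      (∀ n, x n ∈ X) → xl ∈ X → Tendsto x atTop (nhds xl) →
        ∀ z ∈ feas xl, ∃ zseq : ℕ → EuclideanSpace ℝ (Fin d),
          (∀ n, zseq n ∈ feas (x n)) ∧ Tendsto zseq atTop (nhds z))
    (hΦ_conv : ∀ x ∈ X, Convex ℝ (Φ x)) :
    ∃ xstar ∈ X, xstar ∈ Φ xstar ∧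
      ENNReal.ofReal (1 - ε) ≤ P xstar {ξ | g xstar ξ ≤ γ} ∧
      ∀ y ∈ feas xstar, f xstar ≤ f y := by
  have hfeas_sub : ∀ x, feas x ⊆ X := by
    intro x y hy
    rw [hfeas_def] at hy
    exact hy.1
  have hfeas_closed : ∀ (x y : ℕ → EuclideanSpace ℝ (Fin d)) (a b : EuclideanSpace ℝ (Fin d)),
      (∀ n, x n ∈ X) → a ∈ X → Tendsto x atTop (nhds a) →
      (∀ n, y n ∈ feas (x n)) → Tendsto y atTop (nhds b) → b ∈ feas a := by
    intro x y a b hx ha hxa hy hyb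
    rw [hfeas_def]
    refine ⟨hXcomp.isClosed.mem_of_tendsto hyb
      (Eventually.of_forall fun n => hfeas_sub _ (hy n)), ?_⟩
    refine feas_closed X g hg_cont P hPprob hPweak γ _ x y a b hx ha hxa hyb ?_
    intro n
    have := hy n
    rw [hfeas_def] at this
    exact this.2
  have hΦ_ne : ∀ x ∈ X, (Φ x).Nonempty := by
    intro x hx
    have hcl : IsClosed (feas x) := by
      refine IsSeqClosed.isClosed ?_
      intro y b hy hyb
      exact hfeas_closed (fun _ => x) y x b (fun _ => hx) hx tendsto_const_nhds hy hyb
    have hc : IsCompact (feas x) := hXcomp.of_isClosed_subset hcl (hfeas_sub x)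
    obtain ⟨y, hy, hmin⟩ := hc.exists_isMinOn (hfeas_ne x hx) (hf.mono (hfeas_sub x))
    refine ⟨y, ?_⟩
    rw [hΦ_def]
    exact ⟨hy, fun z hz => hmin hz⟩
  have hΦ_feas : ∀ x, Φ x ⊆ feas x := by
    intro x y hy
    rw [hΦ_def] at hy
    exact hy.1
  obtain ⟨x, hxX, hx⟩ := kakutani X hXne hXcomp hXconv Φ
    (fun x _ => (hΦ_feas x).trans (hfeas_sub x)) hΦ_ne hΦ_conv (by
      intro x y a b hx ha hxa hy hyb
      have hb : b ∈ feas a := hfeas_closed x y a b hx ha hxa (fun n => hΦ_feas _ (hy n)) hyb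
      rw [hΦ_def]
      refine ⟨hb, fun z hz => ?_⟩
      obtain ⟨zs, hzs, hzl⟩ := hfeas_lhc x a hx ha hxa z hz
      have h1 : Tendsto (fun n => f (y n)) atTop (nhds (f b)) :=
        (hf b (hfeas_sub _ hb)).tendsto.comp (tendsto_nhdsWithin_iff.2
          ⟨hyb, Eventually.of_forall fun n => hfeas_sub _ (hΦ_feas _ (hy n))⟩)
      have h2 : Tendsto (fun n => f (zs n)) atTop (nhds (f z)) :=
        (hf z (hfeas_sub _ hz)).tendsto.comp (tendsto_nhdsWithin_iff.2
          ⟨hzl, Eventually.of_forall fun n => hfeas_sub _ (hzs n)⟩)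
      refine le_of_tendsto_of_tendsto' h1 h2 fun n => ?_
      have := hy n
      rw [hΦ_def] at this
      exact this.2 _ (hzs n))
  refine ⟨x, hxX, hx, ?_, ?_⟩
  · have := hΦ_feas x hx
    rw [hfeas_def] at this
    exact this.2
  · rw [hΦ_def] at hx
    exact hx.2
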